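/- Let N be a square-free positive integer and let α₁, α₂, β₁, β₂ be positive integers with gcd(α₁, α₂) = 1 and gcd(β₁, β₂) = 1 satisfying α₁·β₁ = 2N·α₂·β₂, and such that (α₁/α₂)² + (β₁/β₂)² is the square of a rational number. Then exactly one of α₁ and β₁ is even. -/

import Mathlib

/-- The sum of the squares of two odd natural numbers is never a square. -/
theorem not_isSquare_sq_add_sq_of_odd {x y : ℕ} (hx : Odd x) (hy : Odd y) :
    ¬ IsSquare (x ^ 2 + y ^ 2) := by
  rintro ⟨d, hd⟩
  obtain ⟨m, rfl⟩ := hx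
  obtain ⟨n, rfl⟩ := hy
  rcases Nat.even_or_odd' d with ⟨k, rfl | rfl⟩ <;> ring_nf at hd <;> omega

/-- If the squares of two fractions sum to a rational square, then clearing
denominators gives a natural number square. -/
theorem isSquare_of_div_sq_add_div_sq {a b c d : ℕ} (hb : b ≠ 0) (hd : d ≠ 0)
    (h : ∃ γ : ℚ, ((a : ℚ) / b) ^ 2 + ((c : ℚ) / d) ^ 2 = γ ^ 2) :
    IsSquare ((a * d) ^ 2 + (c * b) ^ 2) := by
  obtain ⟨γ, hγ⟩ := h
  rw [← Rat.isSquare_natCast_iff]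
  refine ⟨γ * (b * d), ?_⟩
  have hb' : (b : ℚ) ≠ 0 := by exact_mod_cast hb
  have hd' : (d : ℚ) ≠ 0 := by exact_mod_cast hd
  calc (((a * d) ^ 2 + (c * b) ^ 2 : ℕ) : ℚ)
      = (((a : ℚ) / b) ^ 2 + ((c : ℚ) / d) ^ 2) * (b * d) ^ 2 := by
        push_cast
        field_simp
    _ = γ * (b * d) * (γ * (b * d)) := by
        rw [hγ]
        ring

/-- For a square-free positive `N` with reduced rational legs
`α₁/α₂`, `β₁/β₂` satisfying `α₁·β₁ = 2N·α₂·β₂` and with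
`(α₁/α₂)² + (β₁/β₂)²` a rational square, exactly one of `α₁`, `β₁` is even. -/
theorem stmt2 (N a1 a2 b1 b2 : ℕ)
    (hN : 0 < N) (hsf : Squarefree N)
    (ha1 : 0 < a1) (ha2 : 0 < a2) (hb1 : 0 < b1) (hb2 : 0 < b2)
    (hredA : Nat.Coprime a1 a2) (hredB : Nat.Coprime b1 b2)
    (heq : a1 * b1 = 2 * N * (a2 * b2))
    (hhyp : ∃ γ : ℚ, ((a1 : ℚ) / a2) ^ 2 + ((b1 : ℚ) / b2) ^ 2 = γ ^ 2) :
    Xor' (Even a1) (Even b1) := by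
  have hor : Even a1 ∨ Even b1 := by
    rw [← Nat.even_mul, heq, mul_assoc]
    exact even_two_mul _
  refine (xor_iff_or_and_not_and _ _).mpr ⟨hor, ?_⟩
  rintro ⟨hA, hB⟩
  have ha2_odd : Odd a2 := (hredA.coprime_dvd_left hA.two_dvd).odd_of_left
  have hb2_odd : Odd b2 := (hredB.coprime_dvd_left hB.two_dvd).odd_of_left
  have hsq := isSquare_of_div_sq_add_div_sq ha2.ne' hb2.ne' hhyp
  obtain ⟨u, rfl⟩ := hA.two_dvd
  obtain ⟨v, rfl⟩ := hB.two_dvd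
  have huv : 2 * (u * v) = N * (a2 * b2) := by linarith
  have hN_even : Even N := by
    have h : Even (N * (a2 * b2)) := huv ▸ even_two_mul _
    exact (Nat.even_mul.mp h).resolve_right
      (Nat.not_even_iff_odd.mpr (ha2_odd.mul hb2_odd))
  obtain ⟨M, rfl⟩ := hN_even.two_dvd
  have hM_odd : Odd M :=
    (Nat.coprime_of_squarefree_mul hsf).odd_of_left
  have huv_odd : Odd (u * v) := by
    have h : u * v = M * (a2 * b2) := by linarith
    exact h ▸ hM_odd.mul (ha2_odd.mul hb2_odd)
  obtain ⟨hu, hv⟩ := Nat.odd_mul.mp huv_odd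
  refine not_isSquare_sq_add_sq_of_odd (hu.mul hb2_odd) (hv.mul ha2_odd) ?_
  obtain ⟨c, hc⟩ := hsq
  have hc_even : Even c := by
    have h : Even (c * c) := ⟨2 * ((u * b2) ^ 2 + (v * a2) ^ 2), by rw [← hc]; ring⟩
    simpa [Nat.even_mul] using h
  obtain ⟨d, rfl⟩ := hc_even.two_dvd
  exact ⟨d, by linarith⟩
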